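/- With T_ℓ and O_ℓ as above and Ehrhart polynomials L(T_ℓ,t) = (ℓ³/3)t³ + μ₁t² + μ₂t + 1 and L(O_ℓ,t) = (4ℓ³/3)t³ + ν₁t² + ν₂t + 1, the quadratic coefficients satisfy ν₁ = 2μ₁ = ℓ(D₁+D₂+D₃+D₄)/2, where D₁=gcd over coordinates of α+β+γ, D₂ of α+β−γ, D₃ of α−β+γ, D₄ of −α+β+γ. -/

import Mathlib

open Pointwise

/-- Number of lattice points of ℤ³ in the dilate `t • P` of the polytope
`P = convexHull ℝ V`. -/
noncomputable def hullCount (V : Set (Fin 3 → ℝ)) (t : ℕ) : ℕ :=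
  Set.ncard {p : Fin 3 → ℤ | (fun i => (p i : ℝ)) ∈ (t : ℝ) • convexHull ℝ V}

/-- gcd of the three coordinates of an integer vector. -/
def gcd3 (v : Fin 3 → ℤ) : ℕ := Int.gcd (v 0) (Int.gcd (v 1) (v 2))

/-- Dot product of integer vectors in ℤ³. -/
def dot3 (u v : Fin 3 → ℤ) : ℤ := u 0 * v 0 + u 1 * v 1 + u 2 * v 2

/-- Cast an integer vector to a real vector. -/
def toR (v : Fin 3 → ℤ) : Fin 3 → ℝ := fun i => (v i : ℝ)

/-- Box of small triples. -/
def kbox (s t : ℕ) : Finset (ℕ × ℕ × ℕ) :=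
  (Finset.range 5 ×ˢ Finset.range 5 ×ˢ Finset.range 5).filter
    (fun k => s + (k.1 + k.2.1 + k.2.2) ≤ t)

lemma mem_kbox {s t : ℕ} (ht : t ≤ 4) (k : ℕ × ℕ × ℕ) :
    k ∈ kbox s t ↔ s + (k.1 + k.2.1 + k.2.2) ≤ t := by
  simp only [kbox, Finset.mem_filter, Finset.mem_product, Finset.mem_range]
  constructor
  · exact fun h => h.2
  · intro h
    refine ⟨⟨?_, ?_, ?_⟩, h⟩ <;> omega

set_option maxRecDepth 100000 in
lemma kbox_third (s : ℕ) (hs : s ≤ 3) :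
    ((kbox s 4).card : ℚ) - 3 * (kbox s 3).card + 3 * (kbox s 2).card - (kbox s 1).card = 1 ∧
    ((kbox s 3).card : ℚ) - 2 * (kbox s 2).card + (kbox s 1).card = 4 - s := by
  have h : ∀ s : Fin 4, (kbox s 4).card + 3 * (kbox s 2).card
      = 1 + 3 * (kbox s 3).card + (kbox s 1).card ∧
      (kbox s 3).card + (kbox s 1).card + s = 4 + 2 * (kbox s 2).card := by
    decide
  have := h ⟨s, by omega⟩
  simp only at this
  obtain ⟨h1, h2⟩ := this
  have h1' : ((kbox s 4).card : ℚ) + 3 * (kbox s 2).card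
      = 1 + 3 * (kbox s 3).card + (kbox s 1).card := by exact_mod_cast h1
  have h2' : ((kbox s 3).card : ℚ) + (kbox s 1).card + s
      = 4 + 2 * (kbox s 2).card := by exact_mod_cast h2
  constructor <;> linarith

/-- Ceiling of `S / m`. -/
def cdiv (S m : ℕ) : ℕ := (S + m - 1) / m

lemma cdiv_le_iff {m : ℕ} (hm : 0 < m) (S x : ℕ) : cdiv S m ≤ x ↔ S ≤ x * m := by
  unfold cdiv
  rw [← Nat.lt_succ_iff, Nat.div_lt_iff_lt_mul hm, Nat.succ_mul]
  omega

lemma cdiv_add {m : ℕ} (hm : 0 < m) (S S' a : ℕ) (h : S + S' = a * m) :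
    cdiv S m + cdiv S' m = a + (if m ∣ S then 0 else 1) := by
  have e1 : S = m * (S / m) + S % m := (Nat.div_add_mod S m).symm
  have hr : S % m < m := Nat.mod_lt _ hm
  set q := S / m with hq
  set r := S % m with hrr
  have hqa : q * m ≤ a * m := by nlinarith
  have hqa' : q ≤ a := Nat.le_of_mul_le_mul_right hqa hm
  obtain ⟨b, rfl⟩ := Nat.exists_eq_add_of_le hqa'
  split_ifs with hd
  · have hr0 : r = 0 := Nat.mod_eq_zero_of_dvd hd
    have hS : S = q * m := by rw [e1, hr0]; ring
    have hS' : S' = b * m := by nlinarith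
    have c1 : cdiv S m = q := by
      apply le_antisymm
      · rw [cdiv_le_iff hm]; omega
      · by_contra hc
        push Not at hc
        have := (cdiv_le_iff hm S (cdiv S m)).1 le_rfl
        nlinarith
    have c2 : cdiv S' m = b := by
      apply le_antisymm
      · rw [cdiv_le_iff hm]; omega
      · by_contra hc
        push Not at hc
        have := (cdiv_le_iff hm S' (cdiv S' m)).1 le_rfl
        nlinarith
    omega
  · have hr0 : 0 < r := by
      rcases Nat.eq_zero_or_pos r with h0 | h0
      · exact absurd (Nat.dvd_of_mod_eq_zero h0) hd
      · exact h0
    have hS' : S' + r = b * m := by nlinarith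
    have c1 : cdiv S m = q + 1 := by
      apply le_antisymm
      · rw [cdiv_le_iff hm]; nlinarith
      · by_contra hc
        push Not at hc
        have := (cdiv_le_iff hm S (cdiv S m)).1 le_rfl
        have : cdiv S m * m ≤ q * m := Nat.mul_le_mul_right _ (by omega)
        nlinarith
    have c2 : cdiv S' m = b := by
      apply le_antisymm
      · rw [cdiv_le_iff hm]; omega
      · by_contra hc
        push Not at hc
        have := (cdiv_le_iff hm S' (cdiv S' m)).1 le_rfl
        have : (cdiv S' m + 1) * m ≤ b * m := Nat.mul_le_mul_right _ (by omega)
        nlinarith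
    omega

lemma count_lemma {I X : Type*} [Fintype I] [DecidableEq I] (m : ℕ) (hm : 0 < m) (S : I → ℕ)
    (e : I × (ℕ × ℕ × ℕ) → X) (he : Function.Injective e) (t : ℕ) (ht : t ≤ 4) (A : Set X)
    (hA : A = e '' {x | S x.1 + m * (x.2.1 + x.2.2.1 + x.2.2.2) ≤ t * m}) :
    A.ncard = ∑ i, (kbox (cdiv (S i) m) t).card := by
  classical
  rw [hA, Set.ncard_image_of_injective _ he]
  have : {x : I × (ℕ × ℕ × ℕ) | S x.1 + m * (x.2.1 + x.2.2.1 + x.2.2.2) ≤ t * m}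
      = ((Finset.univ.sigma (fun i => kbox (cdiv (S i) m) t)).map
        (Equiv.sigmaEquivProd I (ℕ × ℕ × ℕ)).toEmbedding : Finset _) := by
    ext ⟨i, k⟩
    simp only [Set.mem_ofPred_eq, Finset.coe_map, Set.mem_image, Finset.mem_coe, Finset.mem_sigma,
      Finset.mem_univ, true_and, Sigma.exists, mem_kbox ht]
    have key : S i + m * (k.1 + k.2.1 + k.2.2) ≤ t * m ↔
        cdiv (S i) m + (k.1 + k.2.1 + k.2.2) ≤ t := by
      by_cases hk : k.1 + k.2.1 + k.2.2 ≤ t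
      · obtain ⟨d, hd⟩ := Nat.exists_eq_add_of_le hk
        rw [hd, add_comm (cdiv _ _), add_le_add_iff_left, cdiv_le_iff hm]
        constructor <;> intro h <;> nlinarith
      · constructor
        · intro h
          have : (t + 1) * m ≤ (k.1 + k.2.1 + k.2.2) * m := Nat.mul_le_mul_right _ (by omega)
          nlinarith
        · intro h; omega
    rw [key]
    constructor
    · intro h; exact ⟨i, k, h, rfl⟩
    · rintro ⟨i', k', h, h'⟩
      have : (i', k') = (i, k) := h'
      simp only [Prod.mk.injEq] at this
      obtain ⟨rfl, rfl⟩ := this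
      exact h
  rw [this, Set.ncard_coe_finset, Finset.card_map, Finset.card_sigma]

/-- Extraction of the quadratic coefficient. -/
lemma quad_lemma {I : Type*} [Fintype I] (m : ℕ) (hm : 0 < m) (S Z : I → ℕ)
    (σ : Equiv.Perm I) (hS : ∀ i, S i + S (σ i) + Z i * m = 3 * m)
    (N : ℕ → ℕ) (hN : ∀ t, t ≤ 4 → 0 < t → N t = ∑ i, (kbox (cdiv (S i) m) t).card)
    (a b c : ℚ) (hP : ∀ t : ℕ, 0 < t → (N t : ℚ) = a * t ^ 3 + b * t ^ 2 + c * t + 1) :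
    (Fintype.card I : ℚ) = 6 * a ∧
    4 * b = ∑ i, ((if m ∣ S i then (1 : ℚ) else 0) + Z i) := by
  have hs : ∀ i, cdiv (S i) m ≤ 3 := fun i => by
    rw [cdiv_le_iff hm]; have := hS i; omega
  have h1 := hP 1 (by norm_num)
  have h2 := hP 2 (by norm_num)
  have h3 := hP 3 (by norm_num)
  have h4 := hP 4 (by norm_num)
  rw [hN _ (by norm_num) (by norm_num)] at h1 h2 h3 h4
  push_cast at h1 h2 h3 h4
  have e3 : ∑ i, (((kbox (cdiv (S i) m) 4).card : ℚ) - 3 * (kbox (cdiv (S i) m) 3).card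
      + 3 * (kbox (cdiv (S i) m) 2).card - (kbox (cdiv (S i) m) 1).card) = ∑ i : I, (1 : ℚ) :=
    Finset.sum_congr rfl fun i _ => (kbox_third _ (hs i)).1
  have e2 : ∑ i, (((kbox (cdiv (S i) m) 3).card : ℚ) - 2 * (kbox (cdiv (S i) m) 2).card
      + (kbox (cdiv (S i) m) 1).card) = ∑ i : I, (4 - (cdiv (S i) m : ℚ)) :=
    Finset.sum_congr rfl fun i _ => (kbox_third _ (hs i)).2
  simp only [Finset.sum_add_distrib, Finset.sum_sub_distrib, ← Finset.mul_sum] at e3 e2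
  have hc : ∑ i : I, (1 : ℚ) = Fintype.card I := by simp
  have hc4 : ∑ i : I, (4 : ℚ) = 4 * Fintype.card I := by simp [mul_comm]
  rw [h1, h2, h3, h4, hc] at e3
  rw [h1, h2, h3, hc4] at e2
  have hcard : (Fintype.card I : ℚ) = 6 * a := by linarith
  refine ⟨hcard, ?_⟩
  have hsym : ∑ i, (cdiv (S (σ i)) m : ℚ) = ∑ i, (cdiv (S i) m : ℚ) :=
    Equiv.sum_comp σ (fun i => (cdiv (S i) m : ℚ))
  have hpt : ∀ i, ((if m ∣ S i then (1 : ℚ) else 0) + Z i)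
      = 4 - (cdiv (S i) m : ℚ) - cdiv (S (σ i)) m := by
    intro i
    have hi := hS i
    have hZ : Z i ≤ 3 := Nat.le_of_mul_le_mul_right (by omega : Z i * m ≤ 3 * m) hm
    have := cdiv_add hm (S i) (S (σ i)) (3 - Z i) (by rw [Nat.sub_mul]; omega)
    have h' : cdiv (S i) m + cdiv (S (σ i)) m + Z i = 3 + (if m ∣ S i then 0 else 1) := by omega
    have h'' : (cdiv (S i) m : ℚ) + cdiv (S (σ i)) m + Z i = 3 + (if m ∣ S i then 0 else 1) := by
      exact_mod_cast h'
    split_ifs at h'' ⊢ <;> linarith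
  rw [Finset.sum_congr rfl fun i _ => hpt i]
  simp only [Finset.sum_sub_distrib, hsym, hc4]
  linarith

/-- Dual bases up to the factor `m`. -/
def Dual3 (m : ℕ) (f w : Fin 3 → Fin 3 → ℤ) : Prop :=
  ∀ i j, dot3 (f i) (w j) = if i = j then (m : ℤ) else 0

lemma dot3_add (u v w : Fin 3 → ℤ) : dot3 u (v + w) = dot3 u v + dot3 u w := by
  simp [dot3]; ring

lemma dot3_sub (u v w : Fin 3 → ℤ) : dot3 u (v - w) = dot3 u v - dot3 u w := by
  simp [dot3]; ring

lemma dot3_smul (u v : Fin 3 → ℤ) (c : ℤ) : dot3 u (c • v) = c * dot3 u v := by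
  simp [dot3]; ring

lemma dual_recon {m : ℕ} (hm : 0 < m) {f w : Fin 3 → Fin 3 → ℤ} (h : Dual3 m f w)
    (p : Fin 3 → ℤ) : (m : ℤ) • p = dot3 (f 0) p • w 0 + dot3 (f 1) p • w 1 + dot3 (f 2) p • w 2 := by
  let A : Matrix (Fin 3) (Fin 3) ℚ := fun i j => (f i j : ℚ)
  let B : Matrix (Fin 3) (Fin 3) ℚ := fun i j => (w j i : ℚ) / m
  have hm' : (m : ℚ) ≠ 0 := by positivity
  have hAB : A * B = 1 := by
    ext i j
    have := h i j
    have h' : (f i 0 * w j 0 + f i 1 * w j 1 + f i 2 * w j 2 : ℚ) = if i = j then (m : ℚ) else 0 := by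
      have := congrArg (Int.cast : ℤ → ℚ) this
      simp only [dot3] at this
      push_cast at this
      exact this
    rw [Matrix.mul_apply, Fin.sum_univ_three, Matrix.one_apply]
    simp only [A, B]
    rw [show (f i 0 : ℚ) * ((w j 0 : ℚ) / m) + f i 1 * (w j 1 / m) + f i 2 * (w j 2 / m)
      = (f i 0 * w j 0 + f i 1 * w j 1 + f i 2 * w j 2) / m by ring, h']
    split_ifs
    · exact div_self hm'
    · simp
  have hBA := mul_eq_one_comm.1 hAB
  ext k
  have key : ((m : ℤ) * p k : ℚ) = ((dot3 (f 0) p * w 0 k + dot3 (f 1) p * w 1 k + dot3 (f 2) p * w 2 k : ℤ) : ℚ) := by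
    have h3 : B.mulVec (A.mulVec (fun i => (p i : ℚ))) = fun i => (p i : ℚ) := by
      rw [Matrix.mulVec_mulVec, hBA, Matrix.one_mulVec]
    have h4 := congrFun h3 k
    simp only [Matrix.mulVec, dotProduct, Fin.sum_univ_three, A, B] at h4
    rw [← h4]
    simp only [dot3]
    push_cast
    field_simp
  simp only [Pi.smul_apply, Pi.add_apply, smul_eq_mul]
  exact_mod_cast key

lemma dual_inj {m : ℕ} (hm : 0 < m) {f w : Fin 3 → Fin 3 → ℤ} (h : Dual3 m f w)
    {p q : Fin 3 → ℤ} (hpq : ∀ i, dot3 (f i) p = dot3 (f i) q) : p = q := by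
  have h1 := dual_recon hm h p
  have h2 := dual_recon hm h q
  rw [hpq 0, hpq 1, hpq 2, ← h2] at h1
  have hm' : (m : ℤ) ≠ 0 := by positivity
  exact smul_right_injective _ hm' h1

/-- Residues modulo `m` of the three linear forms. -/
def resHom (m : ℕ) (f : Fin 3 → Fin 3 → ℤ) : (Fin 3 → ℤ) →+ (Fin 3 → ZMod m) where
  toFun p i := ((dot3 (f i) p : ℤ) : ZMod m)
  map_zero' := by ext i; simp [dot3]
  map_add' p q := by ext i; simp [dot3_add]

lemma resHom_apply (m : ℕ) (f : Fin 3 → Fin 3 → ℤ) (p i) :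
    resHom m f p i = ((dot3 (f i) p : ℤ) : ZMod m) := rfl

lemma exists_point {m : ℕ} [NeZero m] {f w : Fin 3 → Fin 3 → ℤ} (h : Dual3 m f w)
    (x : (resHom m f).range) (n : Fin 3 → ℤ) :
    ∃ p, ∀ i, dot3 (f i) p = ((x : Fin 3 → ZMod m) i).val + m * n i := by
  obtain ⟨x, q, rfl⟩ := x
  refine ⟨q + ((n 0 - dot3 (f 0) q / m) • w 0 + (n 1 - dot3 (f 1) q / m) • w 1
    + (n 2 - dot3 (f 2) q / m) • w 2), fun i => ?_⟩
  simp only [resHom_apply, ZMod.val_intCast, dot3_add, dot3_smul]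
  rw [h i 0, h i 1, h i 2]
  have := Int.emod_add_mul_ediv (dot3 (f i) q) m
  fin_cases i <;> simp at this ⊢ <;> linarith

/-- The point with given residues and quotients. -/
noncomputable def pt {m : ℕ} [NeZero m] {f w : Fin 3 → Fin 3 → ℤ} (h : Dual3 m f w)
    (x : (resHom m f).range) (n : Fin 3 → ℤ) : Fin 3 → ℤ := (exists_point h x n).choose

lemma pt_spec {m : ℕ} [NeZero m] {f w : Fin 3 → Fin 3 → ℤ} (h : Dual3 m f w)
    (x : (resHom m f).range) (n : Fin 3 → ℤ) (i : Fin 3) :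
    dot3 (f i) (pt h x n) = ((x : Fin 3 → ZMod m) i).val + m * n i :=
  (exists_point h x n).choose_spec i

lemma pt_inj {m : ℕ} [NeZero m] {f w : Fin 3 → Fin 3 → ℤ} (h : Dual3 m f w)
    {x y : (resHom m f).range} {n k : Fin 3 → ℤ} (e : pt h x n = pt h y k) : x = y ∧ n = k := by
  have hm : 0 < m := Nat.pos_of_ne_zero (NeZero.ne m)
  have key : ∀ i, (x : Fin 3 → ZMod m) i = (y : Fin 3 → ZMod m) i ∧ n i = k i := by
    intro i
    have h1 := pt_spec h x n i
    rw [e, pt_spec h y k i] at h1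
    have h2 := congrArg (Int.cast : ℤ → ZMod m) h1
    push_cast at h2
    simp at h2
    refine ⟨h2.symm, ?_⟩
    rw [h2] at h1
    have : (m : ℤ) * k i = m * n i := by linarith
    exact (mul_left_cancel₀ (by positivity) this).symm
  exact ⟨Subtype.ext (funext fun i => (key i).1), funext fun i => (key i).2⟩

lemma pt_surj {m : ℕ} [NeZero m] {f w : Fin 3 → Fin 3 → ℤ} (h : Dual3 m f w) (p : Fin 3 → ℤ) :
    pt h ⟨resHom m f p, p, rfl⟩ (fun i => dot3 (f i) p / m) = p := by
  have hm : 0 < m := Nat.pos_of_ne_zero (NeZero.ne m)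
  apply dual_inj hm h
  intro i
  rw [pt_spec]
  simp only [resHom_apply, ZMod.val_intCast]
  exact Int.emod_add_mul_ediv _ _

/-- Triple as a function. -/
def tri {α : Type*} (k : α × α × α) : Fin 3 → α := ![k.1, k.2.1, k.2.2]

lemma tet_image {m : ℕ} [NeZero m] {f w : Fin 3 → Fin 3 → ℤ} (h : Dual3 m f w) (t : ℕ) :
    {p : Fin 3 → ℤ | (∀ i, 0 ≤ dot3 (f i) p) ∧
      dot3 (f 0) p + dot3 (f 1) p + dot3 (f 2) p ≤ t * m}
    = (fun x : (resHom m f).range × (ℕ × ℕ × ℕ) => pt h x.1 (fun i => ((tri x.2 i : ℕ) : ℤ))) ''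
      {x | ((x.1 : Fin 3 → ZMod m) 0).val + ((x.1 : Fin 3 → ZMod m) 1).val
        + ((x.1 : Fin 3 → ZMod m) 2).val + m * (x.2.1 + x.2.2.1 + x.2.2.2) ≤ t * m} := by
  ext p
  constructor
  · rintro ⟨h0, h1⟩
    have hp := pt_surj h p
    have hn : ∀ i, 0 ≤ dot3 (f i) p / m := fun i => Int.ediv_nonneg (h0 i) (by positivity)
    have hfun : (fun i => dot3 (f i) p / (m : ℤ)) = fun i => ((tri ((dot3 (f 0) p / (m : ℤ)).toNat,
        (dot3 (f 1) p / (m : ℤ)).toNat, (dot3 (f 2) p / (m : ℤ)).toNat) i : ℕ) : ℤ) := by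
      funext i
      fin_cases i <;> simp [tri, hn]
    rw [hfun] at hp
    refine ⟨(⟨resHom m f p, p, rfl⟩, _), ?_, hp⟩
    have s0 := pt_spec h ⟨resHom m f p, p, rfl⟩ (fun i => dot3 (f i) p / m) 0
    have s1 := pt_spec h ⟨resHom m f p, p, rfl⟩ (fun i => dot3 (f i) p / m) 1
    have s2 := pt_spec h ⟨resHom m f p, p, rfl⟩ (fun i => dot3 (f i) p / m) 2
    rw [pt_surj h p] at s0 s1 s2
    simp only [Set.mem_ofPred_eq]
    zify
    rw [Int.toNat_of_nonneg (hn 0), Int.toNat_of_nonneg (hn 1), Int.toNat_of_nonneg (hn 2)]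
    linarith
  · rintro ⟨⟨x, k⟩, hk, rfl⟩
    simp only [Set.mem_ofPred_eq] at hk ⊢
    zify at hk
    simp only [pt_spec]
    refine ⟨fun i => by positivity, ?_⟩
    simp only [tri, Matrix.cons_val]
    linarith

/-- Signed integer from a sign and a natural number. -/
def sgn (b : Bool) (k : ℕ) : ℤ := if b then Int.negSucc k else (k : ℤ)

lemma sgn_inj {b c : Bool} {k l : ℕ} (h : sgn b k = sgn c l) : b = c ∧ k = l := by
  unfold sgn at h
  cases b <;> cases c <;> simp at h ⊢ <;> omega

lemma sgn_surj (n : ℤ) : ∃ b k, sgn b k = n := by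
  cases n with
  | ofNat k => exact ⟨false, k, rfl⟩
  | negSucc k => exact ⟨true, k, rfl⟩

/-- Reflected residue. -/
def rho {m : ℕ} (b : Bool) (x : ZMod m) : ℕ := if b then m - x.val else x.val

lemma abs_sgn {m : ℕ} [NeZero m] (b : Bool) (x : ZMod m) (k : ℕ) :
    |((x.val : ℤ) + m * sgn b k)| = (rho b x : ℤ) + m * k := by
  have hx : x.val < m := ZMod.val_lt x
  unfold sgn rho
  cases b
  · simp only [Bool.false_eq_true, if_false]
    exact abs_of_nonneg (by positivity)
  · simp only [if_true]
    rw [Int.negSucc_eq, Nat.cast_sub hx.le, abs_of_nonpos]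
    · ring
    · have : (x.val : ℤ) < m := by exact_mod_cast hx
      have : (0 : ℤ) ≤ m * k := by positivity
      nlinarith

lemma oct_image {m : ℕ} [NeZero m] {f w : Fin 3 → Fin 3 → ℤ} (h : Dual3 m f w) (t : ℕ) :
    {p : Fin 3 → ℤ | |dot3 (f 0) p| + |dot3 (f 1) p| + |dot3 (f 2) p| ≤ t * m}
    = (fun x : ((resHom m f).range × (Bool × Bool × Bool)) × (ℕ × ℕ × ℕ) =>
        pt h x.1.1 (fun i => sgn (tri x.1.2 i) (tri x.2 i))) ''
      {x | rho x.1.2.1 ((x.1.1 : Fin 3 → ZMod m) 0) + rho x.1.2.2.1 ((x.1.1 : Fin 3 → ZMod m) 1)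
        + rho x.1.2.2.2 ((x.1.1 : Fin 3 → ZMod m) 2) + m * (x.2.1 + x.2.2.1 + x.2.2.2) ≤ t * m} := by
  have key : ∀ x : ((resHom m f).range × (Bool × Bool × Bool)) × (ℕ × ℕ × ℕ),
      |dot3 (f 0) (pt h x.1.1 (fun i => sgn (tri x.1.2 i) (tri x.2 i)))|
      + |dot3 (f 1) (pt h x.1.1 (fun i => sgn (tri x.1.2 i) (tri x.2 i)))|
      + |dot3 (f 2) (pt h x.1.1 (fun i => sgn (tri x.1.2 i) (tri x.2 i)))| ≤ t * m ↔
      rho x.1.2.1 ((x.1.1 : Fin 3 → ZMod m) 0) + rho x.1.2.2.1 ((x.1.1 : Fin 3 → ZMod m) 1)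
        + rho x.1.2.2.2 ((x.1.1 : Fin 3 → ZMod m) 2) + m * (x.2.1 + x.2.2.1 + x.2.2.2) ≤ t * m := by
    intro x
    simp only [pt_spec, abs_sgn]
    zify
    simp only [tri, Matrix.cons_val]
    constructor <;> intro hh <;> linarith
  ext p
  constructor
  · intro hp
    choose b k hbk using fun i => sgn_surj (dot3 (f i) p / m)
    have hpp := pt_surj h p
    have hfun : (fun i => dot3 (f i) p / (m : ℤ)) = fun i => sgn (tri (b 0, b 1, b 2) i)
        (tri (k 0, k 1, k 2) i) := by
      funext i
      fin_cases i <;> simp [tri, hbk]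
    rw [hfun] at hpp
    refine ⟨((⟨resHom m f p, p, rfl⟩, (b 0, b 1, b 2)), (k 0, k 1, k 2)), ?_, hpp⟩
    rw [Set.mem_ofPred_eq, ← key]
    simp only [hpp]
    exact hp
  · rintro ⟨x, hx, rfl⟩
    exact (key x).2 hx

lemma tri_inj {α : Type*} {k l : α × α × α} (h : ∀ i, tri k i = tri l i) : k = l := by
  have h0 := h 0
  have h1 := h 1
  have h2 := h 2
  simp [tri] at h0 h1 h2
  ext1
  · exact h0
  · ext1
    · exact h1
    · exact h2

lemma gcd3_dvd_dot (n p : Fin 3 → ℤ) : (gcd3 n : ℤ) ∣ dot3 n p := by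
  have h0 : (gcd3 n : ℤ) ∣ n 0 := Int.gcd_dvd_left _ _
  have h12 : (gcd3 n : ℤ) ∣ (Int.gcd (n 1) (n 2) : ℤ) := Int.gcd_dvd_right _ _
  have h1 : (gcd3 n : ℤ) ∣ n 1 := h12.trans (Int.gcd_dvd_left _ _)
  have h2 : (gcd3 n : ℤ) ∣ n 2 := h12.trans (Int.gcd_dvd_right _ _)
  exact dvd_add (dvd_add (h0.mul_right _) (h1.mul_right _)) (h2.mul_right _)

lemma gcd3_bezout (n : Fin 3 → ℤ) : ∃ p, dot3 n p = gcd3 n := by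
  have e1 := Int.gcd_eq_gcd_ab (n 0) (Int.gcd (n 1) (n 2))
  have e2 := Int.gcd_eq_gcd_ab (n 1) (n 2)
  refine ⟨![Int.gcdA (n 0) (Int.gcd (n 1) (n 2)),
    Int.gcdA (n 1) (n 2) * Int.gcdB (n 0) (Int.gcd (n 1) (n 2)),
    Int.gcdB (n 1) (n 2) * Int.gcdB (n 0) (Int.gcd (n 1) (n 2))], ?_⟩
  unfold gcd3
  rw [e1]
  simp only [dot3, Matrix.cons_val]
  conv_rhs => rw [e2]
  conv_rhs => rw [← e2]
  rw [show (((n 1).gcd (n 2) : ℕ) : ℤ) * (n 0).gcdB ((n 1).gcd (n 2))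
    = (n 1 * (n 1).gcdA (n 2) + n 2 * (n 1).gcdB (n 2)) * (n 0).gcdB ((n 1).gcd (n 2)) by rw [← e2]]
  ring

open Classical in
lemma kernel_card {m : ℕ} [NeZero m] (f : Fin 3 → Fin 3 → ℤ) (g : (Fin 3 → ZMod m) →+ ZMod m)
    (n : Fin 3 → ℤ) (hg : ∀ p, g (resHom m f p) = ((dot3 n p : ℤ) : ZMod m))
    (hD : gcd3 n ∣ m) :
    (∑ x : (resHom m f).range, if g x = 0 then (1 : ℚ) else 0) * m
      = Fintype.card (resHom m f).range * gcd3 n := by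
  let G : (resHom m f).range →+ ZMod m := g.comp (resHom m f).range.subtype
  have h1 : Nat.card G.ker * Nat.card G.range = Nat.card (resHom m f).range := by
    rw [← AddSubgroup.index_ker, AddSubgroup.card_mul_index]
  have hr : G.range = AddSubgroup.zmultiples ((gcd3 n : ℕ) : ZMod m) := by
    ext y
    rw [AddSubgroup.mem_zmultiples_iff]
    constructor
    · rintro ⟨⟨_, p, rfl⟩, rfl⟩
      obtain ⟨c, hc⟩ := gcd3_dvd_dot n p
      refine ⟨c, ?_⟩
      show _ = g (resHom m f p)
      rw [hg, hc]
      simp [mul_comm]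
    · rintro ⟨c, rfl⟩
      obtain ⟨p, hp⟩ := gcd3_bezout n
      refine ⟨⟨resHom m f (c • p), c • p, rfl⟩, ?_⟩
      show g (resHom m f (c • p)) = _
      rw [hg, dot3_smul, hp]
      simp
  have hcr : Nat.card G.range * gcd3 n = m := by
    rw [hr, Nat.card_zmultiples, ZMod.addOrderOf_coe _ (NeZero.ne m), Nat.gcd_eq_right hD]
    exact Nat.div_mul_cancel hD
  have hk : (∑ x : (resHom m f).range, if g x = 0 then (1 : ℚ) else 0) = Nat.card G.ker := by
    rw [Finset.sum_boole, Nat.card_eq_fintype_card]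
    congr 1
    rw [Fintype.card_subtype]
    congr 1
    ext x
    simp [G, AddMonoidHom.mem_ker]
  rw [hk, ← Nat.card_eq_fintype_card, ← h1]
  push_cast
  rw [mul_assoc]
  congr 1
  exact_mod_cast hcr.symm

lemma cone_mem {C : Set (Fin 3 → ℝ)} (hC : Convex ℝ C) {z0 z1 z2 z3 : Fin 3 → ℝ} (h0 : z0 ∈ C)
    (hz0 : z0 = 0) (h1 : z1 ∈ C) (h2 : z2 ∈ C) (h3 : z3 ∈ C) {a b c : ℝ} (ha : 0 ≤ a) (hb : 0 ≤ b)
    (hc : 0 ≤ c) (hs : a + b + c ≤ 1) : a • z1 + b • z2 + c • z3 ∈ C := by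
  have := hC.sum_mem (t := Finset.univ) (w := ![1 - (a + b + c), a, b, c]) (z := ![z0, z1, z2, z3])
    (by intro i _; fin_cases i <;> simp <;> linarith)
    (by simp [Fin.sum_univ_four]; ring)
    (by intro i _; fin_cases i <;> simp [h0, h1, h2, h3])
  simpa [Fin.sum_univ_four, hz0] using this

/-- Real dot product with an integer vector. -/
def rdot (u : Fin 3 → ℤ) (x : Fin 3 → ℝ) : ℝ := u 0 * x 0 + u 1 * x 1 + u 2 * x 2

lemma rdot_add (u x y) : rdot u (x + y) = rdot u x + rdot u y := by simp [rdot]; ring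

lemma rdot_smul (u x) (c : ℝ) : rdot u (c • x) = c * rdot u x := by simp [rdot]; ring

lemma rdot_toR (u p) : rdot u (toR p) = (dot3 u p : ℝ) := by simp [rdot, dot3, toR]

lemma recon_real {m : ℕ} (hm : 0 < m) {f w : Fin 3 → Fin 3 → ℤ} (h : Dual3 m f w)
    (p : Fin 3 → ℤ) {t : ℝ} (ht : 0 < t) : toR p = t • (
      ((dot3 (f 0) p : ℝ) / (t * m)) • toR (w 0) + ((dot3 (f 1) p : ℝ) / (t * m)) • toR (w 1)
        + ((dot3 (f 2) p : ℝ) / (t * m)) • toR (w 2)) := by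
  have h1 := dual_recon hm h p
  ext k
  have h2 := congrArg (Int.cast : ℤ → ℝ) (congrFun h1 k)
  simp only [Pi.smul_apply, Pi.add_apply, smul_eq_mul, toR] at h2 ⊢
  push_cast at h2
  have : (0 : ℝ) < m := by exact_mod_cast hm
  field_simp
  linarith

lemma tet_hull {m : ℕ} (hm : 0 < m) {f w : Fin 3 → Fin 3 → ℤ} (h : Dual3 m f w) (t : ℕ)
    (ht : 0 < t) (p : Fin 3 → ℤ) :
    toR p ∈ (t : ℝ) • convexHull ℝ {toR 0, toR (w 0), toR (w 1), toR (w 2)} ↔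
      (∀ i, 0 ≤ dot3 (f i) p) ∧ dot3 (f 0) p + dot3 (f 1) p + dot3 (f 2) p ≤ t * m := by
  have htR : (0 : ℝ) < t := by exact_mod_cast ht
  have hmR : (0 : ℝ) < m := by exact_mod_cast hm
  constructor
  · rintro ⟨y, hy, hyp⟩
    have hsub : convexHull ℝ {toR 0, toR (w 0), toR (w 1), toR (w 2)} ⊆
        {x | (∀ i, 0 ≤ rdot (f i) x) ∧ rdot (f 0) x + rdot (f 1) x + rdot (f 2) x ≤ m} := by
      apply convexHull_min
      · intro x hx
        simp only [Set.mem_insert_iff, Set.mem_singleton_iff] at hx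
        have h0 : ∀ i, dot3 (f i) 0 = 0 := fun i => by simp [dot3]
        rcases hx with rfl | rfl | rfl | rfl
        · simp [rdot_toR, h0]
        all_goals
          simp only [Set.mem_ofPred_eq, rdot_toR, h _ _]
          refine ⟨fun i => ?_, ?_⟩
          · split_ifs <;> simp
          · simp
      · intro x hx y hy a b ha hb hab
        simp only [Set.mem_ofPred_eq, rdot_add, rdot_smul] at hx hy ⊢
        refine ⟨fun i => add_nonneg (mul_nonneg ha (hx.1 i)) (mul_nonneg hb (hy.1 i)), ?_⟩
        have h1 := mul_le_mul_of_nonneg_left hx.2 ha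
        have h2 := mul_le_mul_of_nonneg_left hy.2 hb
        have : a * m + b * m = (m : ℝ) := by rw [← add_mul, hab, one_mul]
        linarith
    obtain ⟨hy1, hy2⟩ := hsub hy
    have hf : ∀ i, (dot3 (f i) p : ℝ) = t * rdot (f i) y := fun i => by
      rw [← rdot_toR, ← hyp, ← rdot_smul]
    constructor
    · intro i
      have : (0 : ℝ) ≤ (dot3 (f i) p : ℝ) := by rw [hf]; exact mul_nonneg htR.le (hy1 i)
      exact_mod_cast this
    · have : (dot3 (f 0) p : ℝ) + dot3 (f 1) p + dot3 (f 2) p ≤ t * m := by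
        rw [hf, hf, hf, ← mul_add, ← mul_add]
        exact mul_le_mul_of_nonneg_left hy2 htR.le
      exact_mod_cast this
  · rintro ⟨h0, h1⟩
    rw [recon_real hm h p htR]
    have h0R : ∀ i, (0 : ℝ) ≤ dot3 (f i) p := fun i => by exact_mod_cast h0 i
    have h1R : (dot3 (f 0) p : ℝ) + dot3 (f 1) p + dot3 (f 2) p ≤ t * m := by exact_mod_cast h1
    apply Set.smul_mem_smul_set
    apply cone_mem (convex_convexHull ℝ _) (z0 := toR 0) (subset_convexHull ℝ _ (by simp))
      (by ext i; simp [toR]) (subset_convexHull ℝ _ (by simp)) (subset_convexHull ℝ _ (by simp))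
      (subset_convexHull ℝ _ (by simp)) (div_nonneg (h0R 0) (by positivity))
      (div_nonneg (h0R 1) (by positivity)) (div_nonneg (h0R 2) (by positivity))
    rw [← add_div, ← add_div, div_le_one (by positivity)]
    exact h1R

lemma toR_neg (v) : toR (-v) = - toR v := by ext i; simp [toR]

lemma abs_sign_smul {C : Set (Fin 3 → ℝ)} {v : Fin 3 → ℤ} (h1 : toR v ∈ C) (h2 : toR (-v) ∈ C)
    (c : ℝ) : ∃ z ∈ C, c • toR v = |c| • z := by
  rcases le_total 0 c with hc | hc
  · exact ⟨_, h1, by rw [abs_of_nonneg hc]⟩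
  · exact ⟨_, h2, by rw [abs_of_nonpos hc, toR_neg]; simp⟩

lemma oct_hull {m : ℕ} (hm : 0 < m) {f w : Fin 3 → Fin 3 → ℤ} (h : Dual3 m f w) (t : ℕ)
    (ht : 0 < t) (p : Fin 3 → ℤ) :
    toR p ∈ (t : ℝ) • convexHull ℝ {toR (w 0), toR (-w 0), toR (w 1), toR (-w 1),
      toR (w 2), toR (-w 2)} ↔
      |dot3 (f 0) p| + |dot3 (f 1) p| + |dot3 (f 2) p| ≤ t * m := by
  have htR : (0 : ℝ) < t := by exact_mod_cast ht
  have hmR : (0 : ℝ) < m := by exact_mod_cast hm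
  constructor
  · rintro ⟨y, hy, hyp⟩
    have hsub : convexHull ℝ {toR (w 0), toR (-w 0), toR (w 1), toR (-w 1),
      toR (w 2), toR (-w 2)} ⊆
        {x | |rdot (f 0) x| + |rdot (f 1) x| + |rdot (f 2) x| ≤ m} := by
      apply convexHull_min
      · intro x hx
        simp only [Set.mem_insert_iff, Set.mem_singleton_iff] at hx
        have hneg : ∀ u v, dot3 u (-v) = - dot3 u v := fun u v => by simp [dot3]; ring
        rcases hx with rfl | rfl | rfl | rfl | rfl | rfl
        all_goals
          simp only [Set.mem_ofPred_eq, rdot_toR, hneg, h _ _]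
          simp
      · intro x hx y hy a b ha hb hab
        simp only [Set.mem_ofPred_eq, rdot_add, rdot_smul] at hx hy ⊢
        have h1 := mul_le_mul_of_nonneg_left hx ha
        have h2 := mul_le_mul_of_nonneg_left hy hb
        have : a * m + b * m = (m : ℝ) := by rw [← add_mul, hab, one_mul]
        have habs : ∀ i, |a * rdot (f i) x + b * rdot (f i) y| ≤
            a * |rdot (f i) x| + b * |rdot (f i) y| := fun i => by
          refine (abs_add_le _ _).trans ?_
          rw [abs_mul, abs_mul, abs_of_nonneg ha, abs_of_nonneg hb]
        have := habs 0
        have := habs 1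
        have := habs 2
        linarith
    have hy2 := hsub hy
    simp only [Set.mem_ofPred_eq] at hy2
    have hf : ∀ i, |(dot3 (f i) p : ℝ)| = t * |rdot (f i) y| := fun i => by
      rw [← rdot_toR, ← hyp, ← abs_of_pos htR, ← abs_mul, abs_of_pos htR, ← rdot_smul]
    have : |(dot3 (f 0) p : ℝ)| + |(dot3 (f 1) p : ℝ)| + |(dot3 (f 2) p : ℝ)| ≤ t * m := by
      rw [hf, hf, hf, ← mul_add, ← mul_add]
      exact mul_le_mul_of_nonneg_left hy2 htR.le
    exact_mod_cast this
  · intro h1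
    rw [recon_real hm h p htR]
    have h1R : |(dot3 (f 0) p : ℝ)| + |(dot3 (f 1) p : ℝ)| + |(dot3 (f 2) p : ℝ)| ≤ t * m := by
      exact_mod_cast h1
    apply Set.smul_mem_smul_set
    set C := convexHull ℝ {toR (w 0), toR (-w 0), toR (w 1), toR (-w 1), toR (w 2), toR (-w 2)}
      with hC
    have a0 : toR (w 0) ∈ C := subset_convexHull ℝ _ (by simp)
    have b0 : toR (-w 0) ∈ C := subset_convexHull ℝ _ (by simp)
    have a1 : toR (w 1) ∈ C := subset_convexHull ℝ _ (by simp)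
    have b1 : toR (-w 1) ∈ C := subset_convexHull ℝ _ (by simp)
    have a2 : toR (w 2) ∈ C := subset_convexHull ℝ _ (by simp)
    have b2 : toR (-w 2) ∈ C := subset_convexHull ℝ _ (by simp)
    have hCc : Convex ℝ C := convex_convexHull ℝ _
    have hz : (0 : Fin 3 → ℝ) ∈ C := by
      have := hCc a0 b0 (a := 1 / 2) (b := 1 / 2) (by norm_num) (by norm_num) (by norm_num)
      rwa [toR_neg, smul_neg, add_neg_cancel] at this
    obtain ⟨z0, hz0, e0⟩ := abs_sign_smul a0 b0 ((dot3 (f 0) p : ℝ) / (t * m))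
    obtain ⟨z1, hz1, e1⟩ := abs_sign_smul a1 b1 ((dot3 (f 1) p : ℝ) / (t * m))
    obtain ⟨z2, hz2, e2⟩ := abs_sign_smul a2 b2 ((dot3 (f 2) p : ℝ) / (t * m))
    rw [e0, e1, e2]
    apply cone_mem hCc hz rfl hz0 hz1 hz2 (abs_nonneg _) (abs_nonneg _) (abs_nonneg _)
    rw [abs_div, abs_div, abs_div, ← add_div, ← add_div,
      abs_of_pos (by positivity : (0 : ℝ) < t * m), div_le_one (by positivity)]
    exact h1R

/-- Signed sum of coordinates. -/
def lin (m : ℕ) (c : Fin 3 → ℤ) : (Fin 3 → ZMod m) →+ ZMod m where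
  toFun x := c 0 * x 0 + c 1 * x 1 + c 2 * x 2
  map_zero' := by simp
  map_add' x y := by simp; ring

lemma lin_apply (m c x) : lin m c x = c 0 * x 0 + c 1 * x 1 + c 2 * x 2 := rfl

open Classical in
lemma kernel_lin {m : ℕ} [NeZero m] (f : Fin 3 → Fin 3 → ℤ) (c : Fin 3 → ℤ) (n q : Fin 3 → ℤ)
    (hn : n = c 0 • f 0 + c 1 • f 1 + c 2 • f 2) (hq : dot3 n q = m) :
    (∑ x : (resHom m f).range,
      if (c 0 * (x : Fin 3 → ZMod m) 0 + c 1 * (x : Fin 3 → ZMod m) 1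
        + c 2 * (x : Fin 3 → ZMod m) 2) = 0 then (1 : ℚ) else 0) * m
      = Fintype.card (resHom m f).range * gcd3 n := by
  apply kernel_card f (lin m c) n
  · intro p
    rw [lin_apply, hn]
    simp only [resHom_apply, dot3]
    simp
    ring
  · have := gcd3_dvd_dot n q
    rw [hq] at this
    exact_mod_cast this

open Classical in
lemma tet_final {m : ℕ} [NeZero m] {f w : Fin 3 → Fin 3 → ℤ} (h : Dual3 m f w) (a b c : ℚ)
    (hP : ∀ t : ℕ, 0 < t →
      (hullCount {toR 0, toR (w 0), toR (w 1), toR (w 2)} t : ℚ)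
        = a * t ^ 3 + b * t ^ 2 + c * t + 1) :
    4 * b * m = 6 * a * (gcd3 (f 0 + f 1 + f 2) + gcd3 (f 0) + gcd3 (f 1) + gcd3 (f 2)) := by
  have hm : 0 < m := Nat.pos_of_ne_zero (NeZero.ne m)
  let S : (resHom m f).range → ℕ := fun x => ((x : Fin 3 → ZMod m) 0).val
    + ((x : Fin 3 → ZMod m) 1).val + ((x : Fin 3 → ZMod m) 2).val
  let Z : (resHom m f).range → ℕ := fun x => (if (x : Fin 3 → ZMod m) 0 = 0 then 1 else 0)
    + (if (x : Fin 3 → ZMod m) 1 = 0 then 1 else 0) + (if (x : Fin 3 → ZMod m) 2 = 0 then 1 else 0)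
  have hq := quad_lemma m hm S Z (Equiv.neg _) (by
      intro x
      have key : ∀ y : ZMod m, y.val + (-y).val + (if y = 0 then 1 else 0) * m = m := by
        intro y
        rw [ZMod.neg_val]
        have := ZMod.val_lt y
        split_ifs with hy
        · simp [hy]
        · omega
      have k0 := key ((x : Fin 3 → ZMod m) 0)
      have k1 := key ((x : Fin 3 → ZMod m) 1)
      have k2 := key ((x : Fin 3 → ZMod m) 2)
      simp only [S, Z, Equiv.neg_apply, AddSubgroup.coe_neg, Pi.neg_apply, add_mul]
      omega)
    (hullCount {toR 0, toR (w 0), toR (w 1), toR (w 2)})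
    (by
      intro t ht ht0
      refine count_lemma m hm S (fun x : (resHom m f).range × (ℕ × ℕ × ℕ) =>
        pt h x.1 (fun i => ((tri x.2 i : ℕ) : ℤ))) ?_ t ht _ ?_
      · rintro ⟨x, k⟩ ⟨y, l⟩ hxy
        obtain ⟨h1, h2⟩ := pt_inj h hxy
        have : k = l := tri_inj fun i => by exact_mod_cast congrFun h2 i
        exact Prod.ext h1 this
      · rw [← tet_image h t]
        ext p
        exact tet_hull hm h t ht0 p) a b c hP
  obtain ⟨hc, hb⟩ := hq
  have hdvd : ∀ x, m ∣ S x ↔ ((x : Fin 3 → ZMod m) 0 + (x : Fin 3 → ZMod m) 1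
      + (x : Fin 3 → ZMod m) 2) = 0 := by
    intro x
    rw [← ZMod.natCast_eq_zero_iff]
    simp [S]
  have k := kernel_lin (m := m) f ![1, 1, 1] (f 0 + f 1 + f 2) (w 0) (by simp)
    (by have := h 0 0; have := h 1 0; have := h 2 0; simp [dot3] at *; linarith)
  have k0 := kernel_lin (m := m) f ![1, 0, 0] (f 0) (w 0) (by simp) (by simpa using h 0 0)
  have k1 := kernel_lin (m := m) f ![0, 1, 0] (f 1) (w 1) (by simp) (by simpa using h 1 1)
  have k2 := kernel_lin (m := m) f ![0, 0, 1] (f 2) (w 2) (by simp) (by simpa using h 2 2)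
  simp only [Matrix.cons_val, Int.cast_one, Int.cast_zero, one_mul, zero_mul, add_zero,
    zero_add] at k k0 k1 k2
  rw [hb]
  simp only [hdvd, Z, Nat.cast_add, Nat.cast_ite, Nat.cast_one, Nat.cast_zero,
    Finset.sum_add_distrib]
  rw [hc] at k k0 k1 k2
  linarith

open Classical in
lemma oct_final {m : ℕ} [NeZero m] {f w : Fin 3 → Fin 3 → ℤ} (h : Dual3 m f w) (a b c : ℚ)
    (hP : ∀ t : ℕ, 0 < t →
      (hullCount {toR (w 0), toR (-w 0), toR (w 1), toR (-w 1), toR (w 2), toR (-w 2)} t : ℚ)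
        = a * t ^ 3 + b * t ^ 2 + c * t + 1) :
    16 * b * m = 6 * a * (gcd3 (f 0 + f 1 + f 2) + gcd3 (f 0 + f 1 - f 2)
      + gcd3 (f 0 - f 1 + f 2) + gcd3 (-f 0 + f 1 + f 2)) := by
  have hm : 0 < m := Nat.pos_of_ne_zero (NeZero.ne m)
  let S : (resHom m f).range × (Bool × Bool × Bool) → ℕ := fun x =>
    rho x.2.1 ((x.1 : Fin 3 → ZMod m) 0) + rho x.2.2.1 ((x.1 : Fin 3 → ZMod m) 1)
      + rho x.2.2.2 ((x.1 : Fin 3 → ZMod m) 2)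
  let bn : Bool ≃ Bool := Equiv.boolNot
  have hq := quad_lemma m hm S (fun _ => 0)
    (Equiv.prodCongr (Equiv.refl _) (Equiv.prodCongr bn (Equiv.prodCongr bn bn))) (by
      rintro ⟨x, e1, e2, e3⟩
      have key : ∀ (e : Bool) (y : ZMod m), rho e y + rho (!e) y = m := by
        intro e y
        have := ZMod.val_lt y
        cases e <;> simp [rho] <;> omega
      have k0 := key e1 ((x : Fin 3 → ZMod m) 0)
      have k1 := key e2 ((x : Fin 3 → ZMod m) 1)
      have k2 := key e3 ((x : Fin 3 → ZMod m) 2)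
      simp only [S, bn, Equiv.prodCongr_apply, Prod.map, Equiv.refl_apply, Equiv.boolNot_apply]
      omega)
    (hullCount {toR (w 0), toR (-w 0), toR (w 1), toR (-w 1), toR (w 2), toR (-w 2)})
    (by
      intro t ht ht0
      refine count_lemma m hm S
        (fun x : ((resHom m f).range × (Bool × Bool × Bool)) × (ℕ × ℕ × ℕ) =>
        pt h x.1.1 (fun i => sgn (tri x.1.2 i) (tri x.2 i))) ?_ t ht _ ?_
      · rintro ⟨⟨x, d⟩, k⟩ ⟨⟨y, e⟩, l⟩ hxy
        obtain ⟨h1, h2⟩ := pt_inj h hxy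
        have hkl : k = l := tri_inj fun i => (sgn_inj (congrFun h2 i)).2
        have hde : d = e := tri_inj fun i => (sgn_inj (congrFun h2 i)).1
        exact Prod.ext (Prod.ext h1 hde) hkl
      · rw [← oct_image h t]
        ext p
        exact oct_hull hm h t ht0 p) a b c hP
  obtain ⟨hc, hb⟩ := hq
  have hrho : ∀ (e : Bool) (y : ZMod m), ((rho e y : ℕ) : ZMod m) = if e then -y else y := by
    intro e y
    have := (ZMod.val_lt y).le
    cases e <;> simp [rho, Nat.cast_sub this]
  have hdvd : ∀ x, m ∣ S x ↔ ((if x.2.1 then -((x.1 : Fin 3 → ZMod m) 0) else (x.1 : Fin 3 → ZMod m) 0)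
      + (if x.2.2.1 then -((x.1 : Fin 3 → ZMod m) 1) else (x.1 : Fin 3 → ZMod m) 1)
      + (if x.2.2.2 then -((x.1 : Fin 3 → ZMod m) 2) else (x.1 : Fin 3 → ZMod m) 2)) = 0 := by
    intro x
    rw [← ZMod.natCast_eq_zero_iff]
    simp only [S, Nat.cast_add, hrho]
  have d00 := h 0 0
  have d10 := h 1 0
  have d20 := h 2 0
  have d01 := h 0 1
  have d11 := h 1 1
  have d21 := h 2 1
  have k1 := kernel_lin (m := m) f ![1, 1, 1] (f 0 + f 1 + f 2) (w 0) (by simp)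
    (by simp [dot3] at *; linarith)
  have k2 := kernel_lin (m := m) f ![1, 1, -1] (f 0 + f 1 - f 2) (w 0) (by simp [sub_eq_add_neg])
    (by simp [dot3] at *; linarith)
  have k3 := kernel_lin (m := m) f ![1, -1, 1] (f 0 - f 1 + f 2) (w 0) (by simp [sub_eq_add_neg])
    (by simp [dot3] at *; linarith)
  have k4 := kernel_lin (m := m) f ![-1, 1, 1] (-f 0 + f 1 + f 2) (w 1) (by simp)
    (by simp [dot3] at *; linarith)
  simp only [Matrix.cons_val, Int.cast_one, Int.cast_neg, one_mul, neg_mul] at k1 k2 k3 k4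
  have n2 : ∀ x y z : ZMod m, (-x + -y + z = 0) = (x + y + -z = 0) := fun x y z => by
    rw [show -x + -y + z = -(x + y + -z) by ring, neg_eq_zero]
  have n3 : ∀ x y z : ZMod m, (-x + y + -z = 0) = (x + -y + z = 0) := fun x y z => by
    rw [show -x + y + -z = -(x + -y + z) by ring, neg_eq_zero]
  have n4 : ∀ x y z : ZMod m, (x + -y + -z = 0) = (-x + y + z = 0) := fun x y z => by
    rw [show x + -y + -z = -(-x + y + z) by ring, neg_eq_zero]
  have hc' : (Fintype.card (resHom m f).range : ℚ) * 8 = 6 * a := by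
    rw [← hc]
    simp only [Fintype.card_prod, Fintype.card_bool]
    push_cast
    ring
  simp only [hdvd, Nat.cast_zero, add_zero, Fintype.sum_prod_type, Fintype.sum_bool, if_true,
    Bool.false_eq_true, if_false, n2, n3, n4, neg_neg, Finset.sum_add_distrib] at hb
  rw [← hc']
  have := congrArg (fun z => z * (m : ℚ)) hb
  simp only [add_mul] at this
  linarith

theorem tet_oct_quadratic_coeff (ℓ : ℤ) (hℓ : 0 < ℓ) (v₁ v₂ v₃ : Fin 3 → ℤ)
    (h11 : dot3 v₁ v₁ = ℓ ^ 2) (h22 : dot3 v₂ v₂ = ℓ ^ 2) (h33 : dot3 v₃ v₃ = ℓ ^ 2)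
    (h12 : dot3 v₁ v₂ = 0) (h13 : dot3 v₁ v₃ = 0) (h23 : dot3 v₂ v₃ = 0)
    (μ₁ μ₂ ν₁ ν₂ : ℚ)
    (hT : ∀ t : ℕ, 0 < t →
      (hullCount {toR 0, toR (v₁ + v₂), toR (v₂ + v₃), toR (v₃ + v₁)} t : ℚ) =
        (ℓ : ℚ) ^ 3 / 3 * t ^ 3 + μ₁ * t ^ 2 + μ₂ * t + 1)
    (hO : ∀ t : ℕ, 0 < t →
      (hullCount {toR v₁, toR (-v₁), toR v₂, toR (-v₂), toR v₃, toR (-v₃)} t : ℚ) =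
        4 * (ℓ : ℚ) ^ 3 / 3 * t ^ 3 + ν₁ * t ^ 2 + ν₂ * t + 1) :
    ν₁ = 2 * μ₁ ∧
    ν₁ = (ℓ : ℚ) * ((gcd3 (v₁ + v₂ + v₃) : ℚ) + gcd3 (v₁ + v₂ - v₃)
      + gcd3 (v₁ - v₂ + v₃) + gcd3 (-v₁ + v₂ + v₃)) / 2 := by
  obtain ⟨l, rfl⟩ := Int.eq_ofNat_of_zero_le hℓ.le
  have hl : 0 < l := by exact_mod_cast hℓ
  have hlQ : (0 : ℚ) < l := by exact_mod_cast hl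
  have c21 : dot3 v₂ v₁ = 0 := by rw [← h12]; simp only [dot3]; ring
  have c31 : dot3 v₃ v₁ = 0 := by rw [← h13]; simp only [dot3]; ring
  have c32 : dot3 v₃ v₂ = 0 := by rw [← h23]; simp only [dot3]; ring
  have : NeZero (l ^ 2) := ⟨by positivity⟩
  have : NeZero (2 * l ^ 2) := ⟨by positivity⟩
  have D1 : Dual3 (l ^ 2) ![v₁, v₂, v₃] ![v₁, v₂, v₃] := by
    intro i j
    fin_cases i <;> fin_cases j <;> simp [*]
  have D2 : Dual3 (2 * l ^ 2) ![v₁ + v₂ - v₃, -v₁ + v₂ + v₃, v₁ - v₂ + v₃]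
      ![v₁ + v₂, v₂ + v₃, v₃ + v₁] := by
    intro i j
    simp only [dot3] at *
    fin_cases i <;> fin_cases j <;> simp <;> linarith
  have T := tet_final D2 _ μ₁ μ₂ hT
  have O := oct_final D1 _ ν₁ ν₂ hO
  simp only [Matrix.cons_val] at T O
  rw [show v₁ + v₂ - v₃ + (-v₁ + v₂ + v₃) + (v₁ - v₂ + v₃) = v₁ + v₂ + v₃ by abel] at T
  push_cast at T O ⊢
  have hμ : μ₁ = (l : ℚ) * ((gcd3 (v₁ + v₂ + v₃) : ℚ) + gcd3 (v₁ + v₂ - v₃)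
      + gcd3 (v₁ - v₂ + v₃) + gcd3 (-v₁ + v₂ + v₃)) / 4 := by
    have h8 : (8 * (l : ℚ) ^ 2) ≠ 0 := by positivity
    apply mul_left_cancel₀ h8
    linear_combination T
  have hν : ν₁ = (l : ℚ) * ((gcd3 (v₁ + v₂ + v₃) : ℚ) + gcd3 (v₁ + v₂ - v₃)
      + gcd3 (v₁ - v₂ + v₃) + gcd3 (-v₁ + v₂ + v₃)) / 2 := by
    have h8 : (16 * (l : ℚ) ^ 2) ≠ 0 := by positivity
    apply mul_left_cancel₀ h8
    linear_combination O
  refine ⟨?_, hν⟩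
  rw [hν, hμ]
  ring
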